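/- For all x,y,z ∈ ℝ and every p = (p₁,p₂,p₃) ∈ ℝ³, the matrix-vector identity N(x,y,z) · v(p) = v(F(p)) holds in ℝ⁵, where v(p) = (−½(2p₁p₃+p₂²), p₁, p₂, p₃, 1) and F(p₁,p₂,p₃) = (p₁ − y p₂ − (y²/2) p₃ + z, p₂ + y p₃ + x, p₃). -/

import Mathlib

/-- The standard Heisenberg matrices `N(x,y,z)` in `O(2,3)`. -/
noncomputable def Nmat (x y z : ℝ) : Matrix (Fin 5) (Fin 5) ℝ :=
  !![1, 0, -x, -(z + x * y), -x ^ 2 / 2;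
     0, 1, -y, -y ^ 2 / 2, z;
     0, 0, 1, y, x;
     0, 0, 0, 1, 0;
     0, 0, 0, 0, 1]

/-- The lift `v(p) = (−½(2p₁p₃ + p₂²), p₁, p₂, p₃, 1)` of the inverse stereographic
projection. -/
noncomputable def stLift (p : Fin 3 → ℝ) : Fin 5 → ℝ :=
  ![-(1 / 2) * (2 * p 0 * p 2 + (p 1) ^ 2), p 0, p 1, p 2, 1]

/-- In the stereographic chart, `N(x,y,z)` acts on Minkowski space by the affine
transformation `p ↦ (p₁ − y p₂ − (y²/2) p₃ + z, p₂ + y p₃ + x, p₃)`: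
the identity `N(x,y,z) · v(p) = v(F(p))` holds in `ℝ⁵`. -/
theorem Nmat_acts_affinely (x y z : ℝ) (p : Fin 3 → ℝ) :
    (Nmat x y z).mulVec (stLift p) =
      stLift ![p 0 - y * p 1 - (y ^ 2 / 2) * p 2 + z, p 1 + y * p 2 + x, p 2] := by
  ext i
  fin_cases i <;>
    simp [Nmat, stLift, Matrix.mulVec, dotProduct, Fin.sum_univ_succ] <;> ring
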